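/- Let T > 0, δ > 0, M > 0, N ∈ ℕ₊, τ = T/N ≤ 1 and t_k = kτ. Let Ã, Q̃ : [0,T] → ℝ^{n×n} and R̃ : [0,T] → ℝ^{m×m} be such that for all t: Q̃(t) is symmetric positive semidefinite, R̃(t) is symmetric with R̃(t) − δI positive semidefinite, ‖Ã(t)‖ ≤ M, ‖Q̃(t)‖ ≤ M, ‖R̃(t)‖ ≤ M, and Ã, Q̃, R̃ are M-Lipschitz in t; let B̃ ∈ ℝ^{n×m} with ‖B̃‖ ≤ M, and let G̃ be symmetric positive semidefinite with ‖G̃‖ ≤ M. For k = 0,…,N−1 let Ã_k, Q̃_k (symmetric positive semidefinite), R̃_k (symmetric with R̃_k − δI positive semidefinite) satisfy ‖Ã_k − Ã(t)‖ + ‖Q̃_k − Q̃(t)‖ + ‖R̃_k − R̃(t)‖ ≤ Mτ for all t ∈ [t_k, t_{k+1}]. Let Π : [0,T] → ℝ^{n×n} be continuously differentiable, symmetric positive semidefinite valued, with Π(T) = G̃ and Π′ + ΠÃ + ÃᵀΠ + Q̃ − ΠB̃R̃⁻¹B̃ᵀΠ = 0 on [0,T]; and let Π_N = G̃, Π_k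 = (I + τÃ_k)ᵀΠ_{k+1}(I + τÃ_k) + τQ̃_k − τH_kᵀW_k⁻¹H_k, where W_k = R̃_k + τB̃ᵀΠ_{k+1}B̃ and H_k = B̃ᵀΠ_{k+1}(I + τÃ_k). Then there exists a constant C depending only on M, δ, T and the dimensions n, m (in particular independent of N and τ) such that max_{l=0,…,N} ‖Π(t_l) − Π_l‖ ≤ Cτ. -/

import Mathlib

open Matrix Set

/-- The spectral norm of a real matrix: the operator norm induced by the Euclidean norms. -/
noncomputable def sNorm {p q : ℕ} (M : Matrix (Fin p) (Fin q) ℝ) : ℝ :=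
  ‖LinearMap.toContinuousLinearMap (Matrix.toEuclideanLin M)‖


open scoped Matrix.Norms.L2Operator

theorem sNorm_eq_norm {p q : ℕ} (A : Matrix (Fin p) (Fin q) ℝ) : sNorm A = ‖A‖ := rfl

namespace Matrix

variable {ι κ : Type*} [Fintype ι] [Fintype κ] [DecidableEq κ]

theorem l2_opNorm_transpose [DecidableEq ι] (A : Matrix ι κ ℝ) : ‖Aᵀ‖ = ‖A‖ := by
  rw [← conjTranspose_eq_transpose_of_trivial, l2_opNorm_conjTranspose]

theorem l2_opNorm_le_of_mulVec_le {A : Matrix ι κ ℝ} {c : ℝ} (hc : 0 ≤ c)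
    (h : ∀ x : EuclideanSpace ℝ κ, ‖WithLp.toLp 2 (A *ᵥ x.ofLp)‖ ≤ c * ‖x‖) : ‖A‖ ≤ c := by
  rw [l2_opNorm_def]
  exact ContinuousLinearMap.opNorm_le_bound _ hc h

theorem abs_entry_le_l2_opNorm (A : Matrix ι κ ℝ) (i : ι) (j : κ) : |A i j| ≤ ‖A‖ := by
  have h := l2_opNorm_mulVec A (EuclideanSpace.single j (1 : ℝ))
  have h2 := PiLp.norm_apply_le (WithLp.toLp 2 (A *ᵥ (EuclideanSpace.single j (1 : ℝ)).ofLp)) i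
  simp at h h2
  exact h2.trans h

theorem abs_trace_le_card_mul_l2_opNorm [DecidableEq ι] (A : Matrix ι ι ℝ) :
    |A.trace| ≤ Fintype.card ι * ‖A‖ := by
  calc |A.trace| ≤ ∑ i, |A i i| := Finset.abs_sum_le_sum_abs _ _
    _ ≤ ∑ _i : ι, ‖A‖ := Finset.sum_le_sum fun i _ => abs_entry_le_l2_opNorm A i i
    _ = Fintype.card ι * ‖A‖ := by simp

theorem sq_l2_opNorm_le_trace (S : Matrix ι κ ℝ) : ‖S‖ * ‖S‖ ≤ (Sᴴ * S).trace := by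
  have ht : (Sᴴ * S).trace = ∑ i, ∑ j, S i j ^ 2 := by
    rw [Finset.sum_comm]
    simp [trace, mul_apply, sq]
  have h0 : 0 ≤ ∑ i, ∑ j, S i j ^ 2 := by positivity
  rw [ht]
  have : ‖S‖ ≤ √(∑ i, ∑ j, S i j ^ 2) := by
    refine l2_opNorm_le_of_mulVec_le (Real.sqrt_nonneg _) fun x => ?_
    rw [EuclideanSpace.norm_eq, EuclideanSpace.norm_eq, ← Real.sqrt_mul h0]
    refine Real.sqrt_le_sqrt ?_
    rw [Finset.sum_mul]
    refine Finset.sum_le_sum fun i _ => ?_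
    simpa [mulVec, dotProduct] using
      Finset.sum_mul_sq_le_sq_mul_sq Finset.univ (S i) x.ofLp
  nlinarith [Real.mul_self_sqrt h0, norm_nonneg S, Real.sqrt_nonneg (∑ i, ∑ j, S i j ^ 2)]

open scoped MatrixOrder in
theorem PosSemidef.l2_opNorm_le_trace [DecidableEq ι] {P : Matrix ι ι ℝ} (hP : P.PosSemidef) :
    ‖P‖ ≤ P.trace := by
  obtain ⟨S, rfl⟩ := CStarAlgebra.nonneg_iff_eq_star_mul_self.mp hP.nonneg
  rw [star_eq_conjTranspose, l2_opNorm_conjTranspose_mul_self]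
  exact sq_l2_opNorm_le_trace S

section Coercive

variable {R : Matrix κ κ ℝ} {δ : ℝ}

theorem PosSemidef.posDef_of_sub_smul_one {μ : Type*} [DecidableEq μ] {R : Matrix μ μ ℝ}
    (hδ : 0 < δ) (hR : (R - δ • (1 : Matrix μ μ ℝ)).PosSemidef) : R.PosDef := by
  have h := (PosDef.one (n := μ) (R := ℝ)).smul hδ
  simpa using PosDef.posSemidef_add hR h

theorem PosSemidef.l2_opNorm_inv_le_of_sub_smul_one (hδ : 0 < δ)
    (hR : (R - δ • (1 : Matrix κ κ ℝ)).PosSemidef) : ‖R⁻¹‖ ≤ δ⁻¹ := by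
  have hu : IsUnit R.det := (isUnit_iff_isUnit_det _).1 (hR.posDef_of_sub_smul_one hδ).isUnit
  refine l2_opNorm_le_of_mulVec_le (by positivity) fun y => ?_
  set x : EuclideanSpace ℝ κ := WithLp.toLp 2 (R⁻¹ *ᵥ y.ofLp) with hx
  have hy : R *ᵥ x.ofLp = y.ofLp := by simp [hx, mul_nonsing_inv R hu]
  have h1 := hR.dotProduct_mulVec_nonneg x.ofLp
  have h2 : inner ℝ x y = x.ofLp ⬝ᵥ y.ofLp := by
    simp [PiLp.inner_apply, dotProduct, mul_comm]
  have h3 : ‖x‖ ^ 2 = x.ofLp ⬝ᵥ x.ofLp := by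
    rw [EuclideanSpace.real_norm_sq_eq]
    simp [dotProduct, sq]
  have h4 := real_inner_le_norm x y
  simp only [star_trivial, sub_mulVec, smul_mulVec, one_mulVec, dotProduct_sub, dotProduct_smul,
    hy, smul_eq_mul] at h1
  rw [← h2, ← h3] at h1
  rcases (norm_nonneg x).eq_or_lt with h0 | h0
  · rw [← h0]; positivity
  · rw [inv_mul_eq_div, le_div_iff₀ hδ]
    by_contra! hc
    nlinarith

theorem l2_opNorm_inv_sub_inv_le (hδ : 0 < δ) {R' : Matrix κ κ ℝ}
    (hR : (R - δ • (1 : Matrix κ κ ℝ)).PosSemidef)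
    (hR' : (R' - δ • (1 : Matrix κ κ ℝ)).PosSemidef) :
    ‖R⁻¹ - R'⁻¹‖ ≤ δ⁻¹ ^ 2 * ‖R - R'‖ := by
  have hu : IsUnit R.det := (isUnit_iff_isUnit_det _).1 (hR.posDef_of_sub_smul_one hδ).isUnit
  have hu' : IsUnit R'.det := (isUnit_iff_isUnit_det _).1 (hR'.posDef_of_sub_smul_one hδ).isUnit
  have h : R⁻¹ - R'⁻¹ = R⁻¹ * (R' - R) * R'⁻¹ := by
    rw [mul_sub, sub_mul, mul_assoc, mul_nonsing_inv R' hu', nonsing_inv_mul R hu]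
    simp
  rw [h, norm_sub_rev R R']
  calc ‖R⁻¹ * (R' - R) * R'⁻¹‖ ≤ ‖R⁻¹‖ * ‖R' - R‖ * ‖R'⁻¹‖ := norm_mul₃_le
    _ ≤ δ⁻¹ * ‖R' - R‖ * δ⁻¹ := by
      gcongr
      exacts [hR.l2_opNorm_inv_le_of_sub_smul_one hδ, hR'.l2_opNorm_inv_le_of_sub_smul_one hδ]
    _ = δ⁻¹ ^ 2 * ‖R' - R‖ := by ring

theorem PosSemidef.add_smul_transpose_mul_mul_sub {τ : ℝ} {P : Matrix ι ι ℝ}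
    {B : Matrix ι κ ℝ} (hτ : 0 ≤ τ) (hP : P.PosSemidef)
    (hR : (R - δ • (1 : Matrix κ κ ℝ)).PosSemidef) :
    (R + τ • (Bᵀ * P * B) - δ • (1 : Matrix κ κ ℝ)).PosSemidef := by
  have h := hR.add ((hP.conjTranspose_mul_mul_same B).smul hτ)
  rw [conjTranspose_eq_transpose_of_trivial] at h
  rwa [add_sub_right_comm]

end Coercive

theorem l2_opNorm_mul_mul_transpose_le [DecidableEq ι] (B : Matrix ι κ ℝ) (X : Matrix κ κ ℝ) :
    ‖B * X * Bᵀ‖ ≤ ‖B‖ ^ 2 * ‖X‖ := by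
  calc ‖B * X * Bᵀ‖ ≤ ‖B‖ * ‖X‖ * ‖Bᵀ‖ :=
        (l2_opNorm_mul _ _).trans (by gcongr; exact l2_opNorm_mul _ _)
    _ = ‖B‖ ^ 2 * ‖X‖ := by rw [l2_opNorm_transpose]; ring

end Matrix

theorem Matrix.hasDerivAt_of_entries {ι κ : Type*} [Fintype ι] [DecidableEq ι] [Fintype κ]
    [DecidableEq κ] {P : ℝ → Matrix ι κ ℝ} {P' : Matrix ι κ ℝ} {t : ℝ}
    (h : ∀ i j, HasDerivAt (fun s => P s i j) (P' i j) t) : HasDerivAt P P' t := by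
  have key : ∀ X : Matrix ι κ ℝ,
      X = ∑ i, ∑ j, X i j • Matrix.single i j (1 : ℝ) := fun X => by
    conv_lhs => rw [matrix_eq_sum_single X]
    simp [Matrix.smul_single]
  have h1 : HasDerivAt (fun s => ∑ i, ∑ j, P s i j • Matrix.single i j (1 : ℝ))
      (∑ i, ∑ j, P' i j • Matrix.single i j (1 : ℝ)) t :=
    HasDerivAt.fun_sum fun i _ => HasDerivAt.fun_sum fun j _ => (h i j).smul_const _
  rw [← key P'] at h1
  simpa only [← key] using h1

theorem le_exp_mul_of_le_one_add_mul_add {x : ℕ → ℝ} {N : ℕ} {a b : ℝ} (ha : 0 ≤ a) (hb : 0 ≤ b)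
    (hN : 0 ≤ x N) (h : ∀ k < N, x k ≤ (1 + a) * x (k + 1) + b) {l : ℕ} (hl : l ≤ N) :
    x l ≤ Real.exp (N * a) * (x N + N * b) := by
  have key : ∀ j ≤ N, x (N - j) ≤ (1 + a) ^ j * (x N + j * b) := by
    intro j
    induction j with
    | zero => simp
    | succ j ih =>
      intro hj
      have h1 := h (N - (j + 1)) (by lia)
      rw [show N - (j + 1) + 1 = N - j by lia] at h1
      have h2 := ih (by lia)
      have h3 : 1 ≤ (1 + a) ^ (j + 1) := one_le_pow₀ (by linarith)
      calc x (N - (j + 1)) ≤ (1 + a) * x (N - j) + b := h1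
        _ ≤ (1 + a) * ((1 + a) ^ j * (x N + j * b)) + (1 + a) ^ (j + 1) * b := by
          gcongr
          exact le_mul_of_one_le_left hb h3
        _ = (1 + a) ^ (j + 1) * (x N + ↑(j + 1) * b) := by push_cast; ring
  have h1 := key (N - l) (by lia)
  rw [Nat.sub_sub_self hl] at h1
  have hj : ((N - l : ℕ) : ℝ) ≤ N := by exact_mod_cast Nat.sub_le N l
  calc x l ≤ (1 + a) ^ (N - l) * (x N + ((N - l : ℕ) : ℝ) * b) := h1
    _ ≤ (1 + a) ^ N * (x N + N * b) := by
      gcongr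
      · linarith
      · lia
    _ ≤ Real.exp a ^ N * (x N + N * b) := by
      gcongr
      linarith [Real.add_one_le_exp a]
    _ = Real.exp (N * a) * (x N + N * b) := by rw [← Real.exp_nat_mul]

theorem le_exp_mul_of_neg_mul_sub_le_deriv {φ φ' : ℝ → ℝ} {T a b : ℝ} (ha : 0 ≤ a) (hb : 0 ≤ b)
    (hd : ∀ t ∈ Icc 0 T, HasDerivAt φ (φ' t) t) (h0 : ∀ t ∈ Icc 0 T, 0 ≤ φ t)
    (h : ∀ t ∈ Icc 0 T, -a * φ t - b ≤ φ' t) {t : ℝ} (ht : t ∈ Icc 0 T) :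
    φ t ≤ Real.exp (a * T) * (φ T + b * T) := by
  set c := b * Real.exp (a * T) with hc
  have hψ : ∀ s ∈ Icc 0 T, HasDerivAt (fun s => Real.exp (a * s) * φ s + c * s)
      (Real.exp (a * s) * a * φ s + Real.exp (a * s) * φ' s + c) s := fun s hs => by
    have h1 := ((hasDerivAt_id s).const_mul a).exp
    have h2 := (h1.fun_mul (hd s hs)).fun_add ((hasDerivAt_id s).const_mul c)
    simpa using h2
  have hmono : MonotoneOn (fun s => Real.exp (a * s) * φ s + c * s) (Icc 0 T) := by
    refine monotoneOn_of_deriv_nonneg (convex_Icc 0 T)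
      (fun s hs => (hψ s hs).continuousAt.continuousWithinAt)
      (fun s hs => (hψ s (interior_subset hs)).differentiableAt.differentiableWithinAt)
      fun s hs => ?_
    replace hs := interior_subset hs
    rw [(hψ s hs).deriv]
    have h1 := mul_le_mul_of_nonneg_left (h s hs) (Real.exp_pos (a * s)).le
    have h2 : b * Real.exp (a * s) ≤ b * Real.exp (a * T) := by
      gcongr
      exact hs.2
    linarith
  have hT : (0 : ℝ) ≤ T := ht.1.trans ht.2
  have h1 := hmono ht (right_mem_Icc.2 hT) ht.2
  have h2 : 1 * φ t ≤ Real.exp (a * t) * φ t := by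
    gcongr
    · exact h0 t ht
    · exact Real.one_le_exp (mul_nonneg ha ht.1)
  have h3 : 0 ≤ c * t := mul_nonneg (by positivity) ht.1
  simp only at h1
  calc φ t ≤ Real.exp (a * T) * φ T + c * T := by linarith
    _ = Real.exp (a * T) * (φ T + b * T) := by ring

theorem norm_sub_le_of_norm_increment_sub_le {E : Type*} [NormedAddCommGroup E] [NormedSpace ℝ E]
    {x y x₁ y₁ f g : E} {τ L c d : ℝ} (hτ : 0 ≤ τ) (hx : ‖x - x₁ - τ • f‖ ≤ c)
    (hy : ‖y - y₁ - τ • g‖ ≤ d) (hfg : ‖f - g‖ ≤ L * ‖x₁ - y₁‖) :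
    ‖x - y‖ ≤ (1 + τ * L) * ‖x₁ - y₁‖ + c + d := by
  have h : x - y = (x₁ - y₁) + τ • (f - g) + (x - x₁ - τ • f) - (y - y₁ - τ • g) := by
    rw [smul_sub]
    abel
  have h1 : ‖τ • (f - g)‖ ≤ τ * (L * ‖x₁ - y₁‖) := by
    rw [norm_smul, Real.norm_eq_abs, abs_of_nonneg hτ]
    gcongr
  rw [h]
  refine (norm_sub_le _ _).trans ?_
  linarith [norm_add₃_le (a := x₁ - y₁) (b := τ • (f - g)) (c := x - x₁ - τ • f)]

namespace Matrix

section Riccati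

variable {ι κ : Type*} [Fintype ι] [DecidableEq ι] [Fintype κ] [DecidableEq κ]

/-- The right-hand side of the backward Riccati equation `-P' = riccatiField P A Q S`, where `S`
stands for `B * R⁻¹ * Bᵀ`. -/
def riccatiField (P A Q S : Matrix ι ι ℝ) : Matrix ι ι ℝ :=
  P * A + Aᵀ * P + Q - P * S * P

/-- One backward step, of size `τ`, of the difference Riccati equation. -/
noncomputable def riccatiStep (τ : ℝ) (A Q : Matrix ι ι ℝ) (R : Matrix κ κ ℝ) (B : Matrix ι κ ℝ)
    (P : Matrix ι ι ℝ) : Matrix ι ι ℝ :=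
  (1 + τ • A)ᵀ * P * (1 + τ • A) + τ • Q
    - τ • ((Bᵀ * P * (1 + τ • A))ᵀ * (R + τ • (Bᵀ * P * B))⁻¹ * (Bᵀ * P * (1 + τ • A)))

theorem norm_riccatiField_le {P A Q S : Matrix ι ι ℝ} {p a q s : ℝ}
    (hP : ‖P‖ ≤ p) (hA : ‖A‖ ≤ a) (hQ : ‖Q‖ ≤ q) (hS : ‖S‖ ≤ s) :
    ‖riccatiField P A Q S‖ ≤ 2 * p * a + q + p ^ 2 * s := by
  have hp : 0 ≤ p := (norm_nonneg _).trans hP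
  have ha : 0 ≤ a := (norm_nonneg _).trans hA
  have hs : 0 ≤ s := (norm_nonneg _).trans hS
  have hA' : ‖Aᵀ‖ ≤ a := by rwa [l2_opNorm_transpose]
  calc ‖riccatiField P A Q S‖ ≤ ‖P‖ * ‖A‖ + ‖Aᵀ‖ * ‖P‖ + ‖Q‖ + ‖P‖ * ‖S‖ * ‖P‖ := by
        refine (norm_sub_le _ _).trans (add_le_add ?_ norm_mul₃_le)
        exact norm_add₃_le.trans (by gcongr <;> exact norm_mul_le _ _)
    _ ≤ p * a + a * p + q + p * s * p := by gcongr
    _ = 2 * p * a + q + p ^ 2 * s := by ring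

theorem norm_riccatiField_sub_le {P₁ A₁ Q₁ S₁ P₂ A₂ Q₂ S₂ : Matrix ι ι ℝ} {p a s : ℝ}
    (hP₁ : ‖P₁‖ ≤ p) (hP₂ : ‖P₂‖ ≤ p) (hA₂ : ‖A₂‖ ≤ a) (hS₂ : ‖S₂‖ ≤ s) :
    ‖riccatiField P₁ A₁ Q₁ S₁ - riccatiField P₂ A₂ Q₂ S₂‖ ≤
      (2 * a + 2 * p * s) * ‖P₁ - P₂‖ + 2 * p * ‖A₁ - A₂‖ + ‖Q₁ - Q₂‖ + p ^ 2 * ‖S₁ - S₂‖ := by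
  have hp : 0 ≤ p := (norm_nonneg _).trans hP₁
  have ha : 0 ≤ a := (norm_nonneg _).trans hA₂
  have hs : 0 ≤ s := (norm_nonneg _).trans hS₂
  have hA' : ‖A₂ᵀ‖ ≤ a := by rwa [l2_opNorm_transpose]
  have h : riccatiField P₁ A₁ Q₁ S₁ - riccatiField P₂ A₂ Q₂ S₂ =
      (P₁ * (A₁ - A₂) + (P₁ - P₂) * A₂) + ((A₁ - A₂)ᵀ * P₁ + A₂ᵀ * (P₁ - P₂)) + (Q₁ - Q₂)
        - (P₁ * (S₁ - S₂) * P₁ + (P₁ - P₂) * S₂ * P₁ + P₂ * S₂ * (P₁ - P₂)) := by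
    simp only [riccatiField, transpose_sub]
    noncomm_ring
  rw [h]
  calc _ ≤ (‖P₁‖ * ‖A₁ - A₂‖ + ‖P₁ - P₂‖ * ‖A₂‖)
          + (‖(A₁ - A₂)ᵀ‖ * ‖P₁‖ + ‖A₂ᵀ‖ * ‖P₁ - P₂‖) + ‖Q₁ - Q₂‖
          + (‖P₁‖ * ‖S₁ - S₂‖ * ‖P₁‖ + ‖P₁ - P₂‖ * ‖S₂‖ * ‖P₁‖ + ‖P₂‖ * ‖S₂‖ * ‖P₁ - P₂‖) := by
        refine (norm_sub_le _ _).trans (add_le_add ?_ ?_)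
        · refine norm_add₃_le.trans ?_
          gcongr
          · exact (norm_add_le _ _).trans (add_le_add (norm_mul_le _ _) (norm_mul_le _ _))
          · exact (norm_add_le _ _).trans (add_le_add (norm_mul_le _ _) (norm_mul_le _ _))
        · exact norm_add₃_le.trans (by gcongr <;> exact norm_mul₃_le)
    _ ≤ (p * ‖A₁ - A₂‖ + ‖P₁ - P₂‖ * a) + (‖A₁ - A₂‖ * p + a * ‖P₁ - P₂‖) + ‖Q₁ - Q₂‖
          + (p * ‖S₁ - S₂‖ * p + ‖P₁ - P₂‖ * s * p + p * s * ‖P₁ - P₂‖) := by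
        rw [l2_opNorm_transpose (A₁ - A₂)]
        gcongr
    _ = _ := by ring

theorem transpose_one_add_smul_mul_mul (τ : ℝ) (A X : Matrix ι ι ℝ) :
    (1 + τ • A)ᵀ * X * (1 + τ • A) =
      X + τ • (Aᵀ * X) + τ • (X * A) + (τ * τ) • (Aᵀ * X * A) := by
  simp only [transpose_add, transpose_one, transpose_smul, add_mul, mul_add, smul_mul_assoc,
    mul_smul_comm, one_mul, mul_one, smul_add, smul_smul]
  abel

theorem norm_transpose_mul_mul_sub_le {τ a : ℝ} (hτ : 0 ≤ τ) (hτ1 : τ ≤ 1) {A : Matrix ι ι ℝ}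
    (hA : ‖A‖ ≤ a) (X : Matrix ι ι ℝ) :
    ‖(1 + τ • A)ᵀ * X * (1 + τ • A) - X‖ ≤ τ * (2 * a + a ^ 2) * ‖X‖ := by
  have ha : 0 ≤ a := (norm_nonneg _).trans hA
  have hA' : ‖Aᵀ‖ ≤ a := by rwa [l2_opNorm_transpose]
  rw [transpose_one_add_smul_mul_mul, add_assoc X, add_assoc X, add_sub_cancel_left]
  calc _ ≤ τ * (‖Aᵀ‖ * ‖X‖) + τ * (‖X‖ * ‖A‖) + (τ * τ) * (‖Aᵀ‖ * ‖X‖ * ‖A‖) := by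
        refine norm_add₃_le.trans ?_
        simp only [norm_smul, Real.norm_eq_abs, abs_of_nonneg hτ, abs_mul]
        gcongr
        · exact norm_mul_le _ _
        · exact norm_mul_le _ _
        · exact norm_mul₃_le
    _ ≤ τ * (a * ‖X‖) + τ * (‖X‖ * a) + (τ * 1) * (a * ‖X‖ * a) := by gcongr
    _ = _ := by ring

variable {τ δ : ℝ} {A Q P : Matrix ι ι ℝ} {R : Matrix κ κ ℝ} {B : Matrix ι κ ℝ}

theorem riccatiStep_eq (hP : Pᵀ = P) :
    riccatiStep τ A Q R B P = (1 + τ • A)ᵀ * P * (1 + τ • A) + τ • Q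
      - τ • ((1 + τ • A)ᵀ * (P * (B * (R + τ • (Bᵀ * P * B))⁻¹ * Bᵀ) * P) * (1 + τ • A)) := by
  simp only [riccatiStep, transpose_mul, transpose_transpose, hP, Matrix.mul_assoc]

theorem PosSemidef.riccatiStep (hτ : 0 ≤ τ) (hδ : 0 < δ) (hP : P.PosSemidef) (hQ : Q.PosSemidef)
    (hR : (R - δ • (1 : Matrix κ κ ℝ)).PosSemidef) : (riccatiStep τ A Q R B P).PosSemidef := by
  have hPt : Pᵀ = P := by
    rw [← conjTranspose_eq_transpose_of_trivial]; exact hP.isHermitian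
  have hWp := (hP.add_smul_transpose_mul_mul_sub (B := B) hτ hR).posDef_of_sub_smul_one hδ
  set W := R + τ • (Bᵀ * P * B) with hW
  have hWt : Wᵀ = W := by
    rw [← conjTranspose_eq_transpose_of_trivial]; exact hWp.isHermitian
  have hu : IsUnit W.det := (isUnit_iff_isUnit_det _).1 hWp.isUnit
  set K := W⁻¹ * (Bᵀ * P) with hK
  have hKt : Kᵀ = P * B * W⁻¹ := by
    simp [hK, transpose_mul, transpose_nonsing_inv, hPt, hWt, Matrix.mul_assoc]
  have hWK : W * K = Bᵀ * P := by rw [hK, mul_nonsing_inv_cancel_left _ _ hu]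
  -- Completing the square.
  have hsq : P - τ • (P * (B * W⁻¹ * Bᵀ) * P) =
      (1 - τ • (B * K))ᵀ * P * (1 - τ • (B * K)) + τ • (Kᵀ * R * K) := by
    have h1 : P * (B * W⁻¹ * Bᵀ) * P = P * B * K := by simp [hK, Matrix.mul_assoc]
    have h2 : Kᵀ * Bᵀ * P = P * B * K := by
      rw [Matrix.mul_assoc, hKt, hK, Matrix.mul_assoc]
    have h3 : Kᵀ * R * K = P * B * K - τ • (P * B * K * B * K) := by
      have : R = W - τ • (Bᵀ * P * B) := by rw [hW]; abel
      rw [this, Matrix.mul_sub, Matrix.sub_mul, Matrix.mul_assoc Kᵀ W, hWK, ← Matrix.mul_assoc Kᵀ,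
        h2]
      simp only [Matrix.mul_smul, Matrix.smul_mul, ← Matrix.mul_assoc, h2]
    rw [h1, h3]
    simp only [transpose_sub, transpose_one, transpose_smul, transpose_mul, Matrix.sub_mul,
      Matrix.mul_sub, Matrix.smul_mul, Matrix.mul_smul, Matrix.one_mul, Matrix.mul_one, h2,
      ← Matrix.mul_assoc, smul_sub, smul_smul]
    abel
  have hRp := (hR.posDef_of_sub_smul_one hδ).posSemidef
  have h1 : (P - τ • (P * (B * W⁻¹ * Bᵀ) * P)).PosSemidef := by
    rw [hsq, ← conjTranspose_eq_transpose_of_trivial, ← conjTranspose_eq_transpose_of_trivial]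
    exact (hP.conjTranspose_mul_mul_same _).add ((hRp.conjTranspose_mul_mul_same _).smul hτ)
  have h2 := (h1.conjTranspose_mul_mul_same (1 + τ • A)).add (hQ.smul hτ)
  rw [conjTranspose_eq_transpose_of_trivial] at h2
  rw [riccatiStep_eq hPt, ← hW]
  convert h2 using 1
  simp only [Matrix.mul_sub, Matrix.sub_mul, Matrix.smul_mul, Matrix.mul_smul]
  abel

theorem trace_riccatiStep_le {a q : ℝ} (hτ : 0 ≤ τ) (hτ1 : τ ≤ 1) (hδ : 0 < δ) (hP : P.PosSemidef)
    (hR : (R - δ • (1 : Matrix κ κ ℝ)).PosSemidef) (hA : ‖A‖ ≤ a) (hQ : ‖Q‖ ≤ q) :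
    (riccatiStep τ A Q R B P).trace ≤
      (1 + τ * (Fintype.card ι * (2 * a + a ^ 2))) * P.trace + τ * (Fintype.card ι * q) := by
  have ha : 0 ≤ a := (norm_nonneg _).trans hA
  have hWp := (hP.add_smul_transpose_mul_mul_sub (B := B) hτ hR).posDef_of_sub_smul_one hδ
  have h1 : 0 ≤ ((Bᵀ * P * (1 + τ • A))ᵀ * (R + τ • (Bᵀ * P * B))⁻¹
      * (Bᵀ * P * (1 + τ • A))).trace := by
    rw [← conjTranspose_eq_transpose_of_trivial (Bᵀ * P * (1 + τ • A))]
    exact (hWp.posSemidef.inv.conjTranspose_mul_mul_same _).trace_nonneg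
  have h2 : ((1 + τ • A)ᵀ * P * (1 + τ • A) - P).trace ≤
      Fintype.card ι * (τ * (2 * a + a ^ 2) * P.trace) := by
    refine (le_abs_self _).trans ((abs_trace_le_card_mul_l2_opNorm _).trans ?_)
    gcongr
    refine (norm_transpose_mul_mul_sub_le hτ hτ1 hA P).trans ?_
    gcongr
    exact hP.l2_opNorm_le_trace
  have h3 : Q.trace ≤ Fintype.card ι * q :=
    (le_abs_self _).trans ((abs_trace_le_card_mul_l2_opNorm _).trans (by gcongr))
  have h4 := mul_le_mul_of_nonneg_left h3 hτ
  have h5 := mul_nonneg hτ h1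
  simp only [Matrix.riccatiStep, trace_sub, trace_add, trace_smul, smul_eq_mul] at h2 ⊢
  linarith

theorem norm_riccatiStep_sub_le {a b p : ℝ} (hτ : 0 ≤ τ) (hτ1 : τ ≤ 1) (hδ : 0 < δ)
    (hP : P.PosSemidef) (hR : (R - δ • (1 : Matrix κ κ ℝ)).PosSemidef)
    (hA : ‖A‖ ≤ a) (hB : ‖B‖ ≤ b) (hPp : ‖P‖ ≤ p) :
    ‖riccatiStep τ A Q R B P - P - τ • riccatiField P A Q (B * R⁻¹ * Bᵀ)‖ ≤
      (a * p * a + (2 * a + a ^ 2) * (p * (b ^ 2 * δ⁻¹) * p)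
        + p * (b ^ 2 * (δ⁻¹ ^ 2 * (b ^ 2 * p))) * p) * τ ^ 2 := by
  have ha : 0 ≤ a := (norm_nonneg _).trans hA
  have hb : 0 ≤ b := (norm_nonneg _).trans hB
  have hp : 0 ≤ p := (norm_nonneg _).trans hPp
  have hA' : ‖Aᵀ‖ ≤ a := by rwa [l2_opNorm_transpose]
  have hPt : Pᵀ = P := by
    rw [← conjTranspose_eq_transpose_of_trivial]; exact hP.isHermitian
  have hWd := hP.add_smul_transpose_mul_mul_sub (B := B) hτ hR
  rw [riccatiStep_eq hPt]
  set W := R + τ • (Bᵀ * P * B) with hW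
  set X := P * (B * W⁻¹ * Bᵀ) * P with hX
  have h : (1 + τ • A)ᵀ * P * (1 + τ • A) + τ • Q - τ • ((1 + τ • A)ᵀ * X * (1 + τ • A)) - P
        - τ • riccatiField P A Q (B * R⁻¹ * Bᵀ) =
      (τ * τ) • (Aᵀ * P * A) - τ • ((1 + τ • A)ᵀ * X * (1 + τ • A) - X)
        - τ • (P * (B * (W⁻¹ - R⁻¹) * Bᵀ) * P) := by
    rw [transpose_one_add_smul_mul_mul τ A P]
    simp only [hX, riccatiField, smul_add, smul_sub, Matrix.mul_sub, Matrix.sub_mul]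
    abel
  rw [h]
  have hXn : ‖X‖ ≤ p * (b ^ 2 * δ⁻¹) * p := by
    refine norm_mul₃_le.trans ?_
    gcongr
    refine (l2_opNorm_mul_mul_transpose_le _ _).trans ?_
    gcongr
    exact hWd.l2_opNorm_inv_le_of_sub_smul_one hδ
  have hWR : ‖W - R‖ ≤ τ * (b ^ 2 * p) := by
    have h1 := l2_opNorm_mul_mul_transpose_le Bᵀ P
    rw [transpose_transpose, l2_opNorm_transpose] at h1
    rw [hW, add_sub_cancel_left, norm_smul, Real.norm_eq_abs, abs_of_nonneg hτ]
    gcongr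
    exact h1.trans (by gcongr)
  have hS : ‖P * (B * (W⁻¹ - R⁻¹) * Bᵀ) * P‖ ≤
      p * (b ^ 2 * (δ⁻¹ ^ 2 * (τ * (b ^ 2 * p)))) * p := by
    refine norm_mul₃_le.trans ?_
    gcongr
    refine (l2_opNorm_mul_mul_transpose_le _ _).trans ?_
    gcongr
    exact (l2_opNorm_inv_sub_inv_le hδ hWd hR).trans (by gcongr)
  calc _ ≤ (τ * τ) * ‖Aᵀ * P * A‖ + τ * ‖(1 + τ • A)ᵀ * X * (1 + τ • A) - X‖
          + τ * ‖P * (B * (W⁻¹ - R⁻¹) * Bᵀ) * P‖ := by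
        refine (norm_sub_le _ _).trans ((add_le_add_left (norm_sub_le _ _) _).trans ?_)
        simp only [norm_smul, Real.norm_eq_abs, abs_of_nonneg hτ, abs_mul, le_refl]
    _ ≤ (τ * τ) * (a * p * a) + τ * (τ * (2 * a + a ^ 2) * (p * (b ^ 2 * δ⁻¹) * p))
          + τ * (p * (b ^ 2 * (δ⁻¹ ^ 2 * (τ * (b ^ 2 * p)))) * p) := by
        gcongr
        · exact norm_mul₃_le.trans (by gcongr)
        · exact (norm_transpose_mul_mul_sub_le hτ hτ1 hA X).trans (by gcongr)
    _ = _ := by ring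

theorem neg_mul_trace_sub_le_trace_neg_riccatiField {a q : ℝ} {P A Q S : Matrix ι ι ℝ}
    (hP : P.PosSemidef) (hS : S.PosSemidef) (hA : ‖A‖ ≤ a) (hQ : ‖Q‖ ≤ q) :
    -(Fintype.card ι * (2 * a)) * P.trace - Fintype.card ι * q ≤
      (-riccatiField P A Q S).trace := by
  have ha : 0 ≤ a := (norm_nonneg _).trans hA
  have h0 : 0 ≤ P.trace := hP.trace_nonneg
  have h1 : (P * A).trace ≤ Fintype.card ι * (P.trace * a) := by
    refine (le_abs_self _).trans ((abs_trace_le_card_mul_l2_opNorm _).trans ?_)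
    gcongr
    refine (norm_mul_le _ _).trans ?_
    gcongr
    exact hP.l2_opNorm_le_trace
  have h2 : (Aᵀ * P).trace = (P * A).trace := by
    have hPt : Pᵀ = P := by
      rw [← conjTranspose_eq_transpose_of_trivial]; exact hP.isHermitian
    rw [← trace_transpose, transpose_mul, transpose_transpose, hPt]
  have h3 : Q.trace ≤ Fintype.card ι * q :=
    (le_abs_self _).trans ((abs_trace_le_card_mul_l2_opNorm _).trans (by gcongr))
  have h4 : 0 ≤ (P * S * P).trace := by
    have h := (hS.conjTranspose_mul_mul_same P).trace_nonneg
    rwa [hP.isHermitian] at h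
  simp only [riccatiField, trace_neg, trace_sub, trace_add]
  linarith

end Riccati

end Matrix

set_option maxHeartbeats 800000 in
theorem stmt14 (T δ M : ℝ) (hT : 0 < T) (hδ : 0 < δ) (hM : 0 < M) (n m : ℕ) :
    ∃ C : ℝ, ∀ N : ℕ, 0 < N → T / (N : ℝ) ≤ 1 →
      ∀ (At Qt : ℝ → Matrix (Fin n) (Fin n) ℝ) (Rt : ℝ → Matrix (Fin m) (Fin m) ℝ)
        (Bt : Matrix (Fin n) (Fin m) ℝ) (Gt : Matrix (Fin n) (Fin n) ℝ)
        (Ad Qd : ℕ → Matrix (Fin n) (Fin n) ℝ) (Rd : ℕ → Matrix (Fin m) (Fin m) ℝ)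
        (Pi Pi' : ℝ → Matrix (Fin n) (Fin n) ℝ) (Pd : ℕ → Matrix (Fin n) (Fin n) ℝ),
      (∀ t ∈ Icc 0 T, (Qt t).PosSemidef) →
      (∀ t ∈ Icc 0 T, (Rt t).IsHermitian) →
      (∀ t ∈ Icc 0 T, (Rt t - δ • (1 : Matrix (Fin m) (Fin m) ℝ)).PosSemidef) →
      (∀ t ∈ Icc 0 T, sNorm (At t) ≤ M) →
      (∀ t ∈ Icc 0 T, sNorm (Qt t) ≤ M) →
      (∀ t ∈ Icc 0 T, sNorm (Rt t) ≤ M) →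
      (∀ s ∈ Icc 0 T, ∀ t ∈ Icc 0 T, sNorm (At t - At s) ≤ M * |t - s|) →
      (∀ s ∈ Icc 0 T, ∀ t ∈ Icc 0 T, sNorm (Qt t - Qt s) ≤ M * |t - s|) →
      (∀ s ∈ Icc 0 T, ∀ t ∈ Icc 0 T, sNorm (Rt t - Rt s) ≤ M * |t - s|) →
      sNorm Bt ≤ M → Gt.PosSemidef → sNorm Gt ≤ M →
      (∀ k < N, (Qd k).PosSemidef) →
      (∀ k < N, (Rd k).IsHermitian) →
      (∀ k < N, (Rd k - δ • (1 : Matrix (Fin m) (Fin m) ℝ)).PosSemidef) →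
      (∀ k < N, ∀ t ∈ Icc ((k : ℝ) * (T / (N : ℝ))) (((k : ℝ) + 1) * (T / (N : ℝ))),
        sNorm (Ad k - At t) + sNorm (Qd k - Qt t) + sNorm (Rd k - Rt t) ≤ M * (T / (N : ℝ))) →
      (∀ i j, ∀ t ∈ Icc 0 T, HasDerivAt (fun s => Pi s i j) (Pi' t i j) t) →
      (∀ i j, ContinuousOn (fun t => Pi' t i j) (Icc 0 T)) →
      (∀ t ∈ Icc 0 T, (Pi t).PosSemidef) →
      Pi T = Gt →
      (∀ t ∈ Icc 0 T, Pi' t + Pi t * At t + (At t)ᵀ * Pi t + Qt t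
          - Pi t * Bt * (Rt t)⁻¹ * Btᵀ * Pi t = 0) →
      Pd N = Gt →
      (∀ k < N, Pd k =
        (1 + (T / (N : ℝ)) • Ad k)ᵀ * Pd (k + 1) * (1 + (T / (N : ℝ)) • Ad k)
          + (T / (N : ℝ)) • Qd k
          - (T / (N : ℝ)) • ((Btᵀ * Pd (k + 1) * (1 + (T / (N : ℝ)) • Ad k))ᵀ
              * (Rd k + (T / (N : ℝ)) • (Btᵀ * Pd (k + 1) * Bt))⁻¹
              * (Btᵀ * Pd (k + 1) * (1 + (T / (N : ℝ)) • Ad k)))) →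
      ∀ l ≤ N, sNorm (Pi ((l : ℝ) * (T / (N : ℝ))) - Pd l) ≤ C * (T / (N : ℝ)) := by
  -- `a`, `q` bound the coefficients, `p` both Riccati solutions, and `s` the quadratic term.
  obtain ⟨a, ha_def⟩ : ∃ x : ℝ, x = 2 * M := ⟨_, rfl⟩
  obtain ⟨s, hs_def⟩ : ∃ x : ℝ, x = M ^ 2 * δ⁻¹ := ⟨_, rfl⟩
  obtain ⟨α, hα_def⟩ : ∃ x : ℝ, x = n * (2 * a + a ^ 2) := ⟨_, rfl⟩
  obtain ⟨β, hβ_def⟩ : ∃ x : ℝ, x = n * a := ⟨_, rfl⟩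
  obtain ⟨p, hp_def⟩ : ∃ x : ℝ, x = Real.exp (α * T) * (n * M + β * T) := ⟨_, rfl⟩
  obtain ⟨K₁, hK₁_def⟩ : ∃ x : ℝ, x = 2 * p * a + a + p ^ 2 * s := ⟨_, rfl⟩
  obtain ⟨L, hL_def⟩ : ∃ x : ℝ, x = 2 * a + 2 * p * s := ⟨_, rfl⟩
  obtain ⟨K₂, hK₂_def⟩ : ∃ x : ℝ, x = L * K₁ + 2 * p * M + M
      + p ^ 2 * (M ^ 2 * (δ⁻¹ ^ 2 * M)) := ⟨_, rfl⟩
  obtain ⟨K₃, hK₃_def⟩ : ∃ x : ℝ, x = a * p * a + (2 * a + a ^ 2) * (p * (M ^ 2 * δ⁻¹) * p)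
        + p * (M ^ 2 * (δ⁻¹ ^ 2 * (M ^ 2 * p))) * p := ⟨_, rfl⟩
  have ha : 0 < a := by rw [ha_def]; positivity
  have hs : 0 < s := by rw [hs_def]; positivity
  have hα : 0 ≤ α := by rw [hα_def]; positivity
  have hβ : 0 ≤ β := by rw [hβ_def]; positivity
  have hp : 0 ≤ p := by rw [hp_def]; positivity
  have hK₁ : 0 ≤ K₁ := by rw [hK₁_def]; positivity
  have hL : 0 ≤ L := by rw [hL_def]; positivity
  have hK₂ : 0 ≤ K₂ := by rw [hK₂_def]; positivity
  have hK₃ : 0 ≤ K₃ := by rw [hK₃_def]; positivity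
  refine ⟨Real.exp (L * T) * (T * (K₂ + K₃)), ?_⟩
  intro N hN hτ1 At Qt Rt Bt Gt Ad Qd Rd Pi Pi' Pd _ _ hRt hAn hQn _ _ _ _ hB hG hGn hQd _ hRd
    hclose hderiv _ hPi hPiT hode hPdN hrec
  simp only [sNorm_eq_norm] at *
  generalize hτ_def : T / (N : ℝ) = τ at *
  have hN' : (0 : ℝ) < N := by exact_mod_cast hN
  have hτ : 0 < τ := by rw [← hτ_def]; positivity
  have hNτ : (N : ℝ) * τ = T := by rw [← hτ_def]; field_simp
  have hGtr : Gt.trace ≤ n * M := by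
    have h := (le_abs_self _).trans (abs_trace_le_card_mul_l2_opNorm Gt)
    rw [Fintype.card_fin] at h
    exact h.trans (by gcongr)
  have hcell : ∀ k < N, ∀ t ∈ Icc ((k : ℝ) * τ) (((k : ℝ) + 1) * τ), t ∈ Icc 0 T := by
    intro k hk t ht
    have h1 : ((k : ℝ) + 1) ≤ N := by exact_mod_cast hk
    refine ⟨le_trans (by positivity) ht.1, ht.2.trans ?_⟩
    rw [← hNτ]
    gcongr
  have hS : ∀ R : Matrix (Fin m) (Fin m) ℝ, (R - δ • (1 : Matrix (Fin m) (Fin m) ℝ)).PosSemidef →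
      ‖Bt * R⁻¹ * Btᵀ‖ ≤ s := by
    intro R hR
    refine (l2_opNorm_mul_mul_transpose_le _ _).trans ?_
    rw [hs_def]
    gcongr
    exact hR.l2_opNorm_inv_le_of_sub_smul_one hδ
  -- The differential equation.
  have hPi' : ∀ t ∈ Icc 0 T,
      Pi' t = -riccatiField (Pi t) (At t) (Qt t) (Bt * (Rt t)⁻¹ * Btᵀ) := by
    intro t ht
    rw [eq_neg_iff_add_eq_zero, ← hode t ht]
    simp only [riccatiField, Matrix.mul_assoc]
    abel
  have hderivM : ∀ t ∈ Icc 0 T, HasDerivAt Pi (Pi' t) t := fun t ht =>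
    hasDerivAt_of_entries fun i j => hderiv i j t ht
  have hAn' : ∀ t ∈ Icc 0 T, ‖At t‖ ≤ a := fun t ht => (hAn t ht).trans (by linarith)
  have hQn' : ∀ t ∈ Icc 0 T, ‖Qt t‖ ≤ a := fun t ht => (hQn t ht).trans (by linarith)
  have hPibd : ∀ t ∈ Icc 0 T, ‖Pi t‖ ≤ p := by
    intro t ht
    refine (hPi t ht).l2_opNorm_le_trace.trans ?_
    have h := le_exp_mul_of_neg_mul_sub_le_deriv (φ := fun t => (Pi t).trace)
      (φ' := fun t => (Pi' t).trace) hα hβ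
      (fun t ht => by
        simpa only [trace, diag_apply] using HasDerivAt.fun_sum fun i _ => hderiv i i t ht)
      (fun t ht => (hPi t ht).trace_nonneg) (fun t ht => ?_) ht
    · refine h.trans ?_
      rw [hp_def, hPiT]
      gcongr
    · have hSp : (Bt * (Rt t)⁻¹ * Btᵀ).PosSemidef := by
        rw [← conjTranspose_eq_transpose_of_trivial]
        exact ((hRt t ht).posDef_of_sub_smul_one hδ).posSemidef.inv.mul_mul_conjTranspose_same Bt
      have h1 := neg_mul_trace_sub_le_trace_neg_riccatiField (hPi t ht) hSp (hAn' t ht) (hQn' t ht)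
      have h2 : 0 ≤ n * a ^ 2 * (Pi t).trace :=
        mul_nonneg (by positivity) (hPi t ht).trace_nonneg
      rw [← hPi' t ht, Fintype.card_fin] at h1
      rw [hα_def, hβ_def]
      linarith
  have hPi'bd : ∀ t ∈ Icc 0 T, ‖Pi' t‖ ≤ K₁ := by
    intro t ht
    rw [hPi' t ht, norm_neg]
    rw [hK₁_def]
    exact norm_riccatiField_le (hPibd t ht) (hAn' t ht) (hQn' t ht) (hS _ (hRt t ht))
  -- The difference equation.
  have hstep : ∀ k < N, Pd k = riccatiStep τ (Ad k) (Qd k) (Rd k) Bt (Pd (k + 1)) := hrec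
  have hAd : ∀ k < N, ‖Ad k‖ ≤ a ∧ ‖Qd k‖ ≤ a := by
    intro k hk
    have hmem : (k : ℝ) * τ ∈ Icc ((k : ℝ) * τ) (((k : ℝ) + 1) * τ) :=
      left_mem_Icc.2 (by gcongr; linarith)
    have h1 := hclose k hk _ hmem
    have h2 := hAn _ (hcell k hk _ hmem)
    have h3 := hQn _ (hcell k hk _ hmem)
    have h4 := norm_le_norm_add_norm_sub' (Ad k) (At ((k : ℝ) * τ))
    have h5 := norm_le_norm_add_norm_sub' (Qd k) (Qt ((k : ℝ) * τ))
    have h6 : M * τ ≤ M := mul_le_of_le_one_right hM.le hτ1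
    have h7 := norm_nonneg (Ad k - At ((k : ℝ) * τ))
    have h8 := norm_nonneg (Qd k - Qt ((k : ℝ) * τ))
    have h9 := norm_nonneg (Rd k - Rt ((k : ℝ) * τ))
    constructor <;> linarith
  have hPdpsd : ∀ k ≤ N, (Pd k).PosSemidef := by
    intro k hk
    induction hk using Nat.decreasingInduction with
    | self => rwa [hPdN]
    | of_succ k hk ih =>
      rw [hstep k hk]
      exact ih.riccatiStep hτ.le hδ (hQd k hk) (hRd k hk)
  have hPdbd : ∀ k ≤ N, ‖Pd k‖ ≤ p := by
    intro k hk
    refine (hPdpsd k hk).l2_opNorm_le_trace.trans ?_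
    have h := le_exp_mul_of_le_one_add_mul_add (x := fun k => (Pd k).trace) (N := N)
      (a := τ * α) (b := τ * β) (by positivity) (by positivity)
      (hPdpsd N le_rfl).trace_nonneg (fun k hk => ?_) hk
    · refine h.trans ?_
      rw [hp_def, hPdN, ← mul_assoc, ← mul_assoc, hNτ, mul_comm T α, mul_comm T β]
      gcongr
    · have h := trace_riccatiStep_le (B := Bt) hτ.le hτ1 hδ (hPdpsd (k + 1) hk) (hRd k hk)
        (hAd k hk).1 (hAd k hk).2
      rw [Fintype.card_fin] at h
      simpa only [hstep k hk, hα_def, hβ_def] using h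
  -- Local truncation error of the differential equation.
  have hlocal : ∀ k < N, ‖Pi ((k : ℝ) * τ) - Pi (((k + 1 : ℕ) : ℝ) * τ)
      - τ • riccatiField (Pi (((k + 1 : ℕ) : ℝ) * τ)) (Ad k) (Qd k) (Bt * (Rd k)⁻¹ * Btᵀ)‖
      ≤ K₂ * τ ^ 2 := by
    intro k hk
    push_cast
    set I := Icc ((k : ℝ) * τ) (((k : ℝ) + 1) * τ) with hI
    set t₁ := ((k : ℝ) + 1) * τ with ht₁
    have hlen : t₁ - (k : ℝ) * τ = τ := by rw [ht₁]; ring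
    have hle : (k : ℝ) * τ ≤ t₁ := by linarith
    have hl : (k : ℝ) * τ ∈ I := left_mem_Icc.2 hle
    have hr : t₁ ∈ I := right_mem_Icc.2 hle
    set F := riccatiField (Pi t₁) (Ad k) (Qd k) (Bt * (Rd k)⁻¹ * Btᵀ) with hF
    have hbd : ∀ t ∈ I, ‖Pi' t + F‖ ≤ K₂ * τ := by
      intro t ht
      have htT := hcell k hk t ht
      have h1 : ‖Pi t - Pi t₁‖ ≤ K₁ * τ := by
        refine ((convex_Icc _ _).norm_image_sub_le_of_norm_hasDerivWithin_le
          (fun x hx => (hderivM x (hcell k hk x hx)).hasDerivWithinAt)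
          (fun x hx => hPi'bd x (hcell k hk x hx)) hr ht).trans ?_
        gcongr
        rw [Real.norm_eq_abs, abs_le]
        constructor <;> linarith [ht.1, ht.2]
      have h2 := hclose k hk t ht
      have h3 := norm_nonneg (Ad k - At t)
      have h4 := norm_nonneg (Qd k - Qt t)
      have h5 := norm_nonneg (Rd k - Rt t)
      have hSd : ‖Bt * (Rd k)⁻¹ * Btᵀ - Bt * (Rt t)⁻¹ * Btᵀ‖ ≤ M ^ 2 * (δ⁻¹ ^ 2 * (M * τ)) := by
        rw [← Matrix.sub_mul, ← Matrix.mul_sub]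
        refine (l2_opNorm_mul_mul_transpose_le _ _).trans ?_
        gcongr
        refine (l2_opNorm_inv_sub_inv_le hδ (hRd k hk) (hRt t htT)).trans ?_
        gcongr
        linarith
      rw [hPi' t htT, neg_add_eq_sub, hF]
      refine (norm_riccatiField_sub_le (hPibd _ (hcell k hk _ hr)) (hPibd t htT) (hAn' t htT)
        (hS _ (hRt t htT))).trans ?_
      rw [norm_sub_rev (Pi t₁)]
      calc _ ≤ L * (K₁ * τ) + 2 * p * (M * τ) + M * τ
            + p ^ 2 * (M ^ 2 * (δ⁻¹ ^ 2 * (M * τ))) := by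
            rw [hL_def]
            gcongr <;> linarith
        _ = K₂ * τ := by rw [hK₂_def]; ring
    have hh : ∀ t ∈ I, HasDerivWithinAt (fun t => Pi t + t • F) (Pi' t + F) I t := fun t ht => by
      have := (hderivM t (hcell k hk t ht)).add ((hasDerivAt_id t).smul_const F)
      rw [one_smul] at this
      exact this.hasDerivWithinAt
    have h := (convex_Icc _ _).norm_image_sub_le_of_norm_hasDerivWithin_le hh hbd hr hl
    rw [norm_sub_rev ((k : ℝ) * τ), hlen, Real.norm_eq_abs, abs_of_pos hτ] at h
    calc _ = ‖Pi ((k : ℝ) * τ) + ((k : ℝ) * τ) • F - (Pi t₁ + t₁ • F)‖ := by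
          have h1 : t₁ • F = ((k : ℝ) * τ) • F + τ • F := by
            rw [← add_smul, ← sub_eq_iff_eq_add'.1 hlen]
          rw [h1]
          congr 1
          abel
      _ ≤ K₂ * τ * τ := h
      _ = K₂ * τ ^ 2 := by ring
  have herr : ∀ k < N, ‖Pi ((k : ℝ) * τ) - Pd k‖ ≤
      (1 + τ * L) * ‖Pi (((k + 1 : ℕ) : ℝ) * τ) - Pd (k + 1)‖ + (K₂ + K₃) * τ ^ 2 := by
    intro k hk
    have h1 := hlocal k hk
    have h2 := norm_riccatiStep_sub_le (Q := Qd k) hτ.le hτ1 hδ (hPdpsd (k + 1) hk) (hRd k hk)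
      (hAd k hk).1 hB (hPdbd (k + 1) hk)
    rw [← hstep k hk, ← hK₃_def] at h2
    have hmem : ((k + 1 : ℕ) : ℝ) * τ ∈ Icc 0 T :=
      hcell k hk _ (by push_cast; exact right_mem_Icc.2 (by linarith))
    set P₁ := Pi (((k + 1 : ℕ) : ℝ) * τ)
    set S := Bt * (Rd k)⁻¹ * Btᵀ
    have h3 : ‖riccatiField P₁ (Ad k) (Qd k) S - riccatiField (Pd (k + 1)) (Ad k) (Qd k) S‖ ≤
        L * ‖P₁ - Pd (k + 1)‖ := by
      refine (norm_riccatiField_sub_le (S₂ := S) (hPibd _ hmem) (hPdbd (k + 1) hk) (hAd k hk).1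
        (hS _ (hRd k hk))).trans_eq ?_
      rw [hL_def, sub_self, sub_self, sub_self, norm_zero]
      ring
    linarith [norm_sub_le_of_norm_increment_sub_le hτ.le h1 h2 h3]
  intro l hl
  have h := le_exp_mul_of_le_one_add_mul_add (x := fun k => ‖Pi ((k : ℝ) * τ) - Pd k‖) (N := N)
    (a := τ * L) (b := (K₂ + K₃) * τ ^ 2) (by positivity) (by positivity) (norm_nonneg _) herr hl
  simp only [hNτ, hPiT, hPdN, sub_self, norm_zero, zero_add] at h
  calc _ ≤ _ := h
    _ = Real.exp (L * (N * τ)) * (N * τ * (K₂ + K₃)) * τ := by ring_nf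
    _ = _ := by rw [hNτ]
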